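/- Let q be an odd prime power and P a monic irreducible polynomial of degree 2 in F_q[T]. Then the number of monic irreducible polynomials Q of degree 2 in F_q[T] with Q a non-square modulo P is (q²-1)/4; in particular it is positive, so such Q exists. -/

import Mathlib

open Polynomial Ideal

/-- In a finite field of odd order, nonsquares are exactly half of the nonzero elements. -/
lemma nonsq_count (K : Type*) [Field K] [Fintype K] (h2 : ringChar K ≠ 2) :
    2 * {x : K | ¬ IsSquare x}.ncard + 1 = Fintype.card K := by
  classical
  obtain ⟨g, hg⟩ := FiniteField.exists_nonsquare h2
  have hg0 : g ≠ 0 := by rintro rfl; exact hg ⟨0, by simp⟩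
  have key : ∀ x : K, x ≠ 0 → (IsSquare (g * x) ↔ ¬ IsSquare x) := by
    intro x hx
    have h := quadraticChar_one_iff_isSquare (mul_ne_zero hg0 hx)
    have hgg := quadraticChar_neg_one_iff_not_isSquare.2 hg
    rw [← h, ← quadraticChar_neg_one_iff_not_isSquare, map_mul, hgg]
    omega
  have hb : Set.BijOn (fun x => g * x) {x : K | x ≠ 0 ∧ IsSquare x} {x : K | ¬ IsSquare x} := by
    refine ⟨?_, ?_, ?_⟩
    · rintro x ⟨hx, hs⟩
      simp only [Set.mem_setOf_eq, key x hx, not_not]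
      exact hs
    · intro x _ y _ h
      exact mul_left_cancel₀ hg0 h
    · intro y hy
      have hy0 : y ≠ 0 := by rintro rfl; exact hy ⟨0, by simp⟩
      have hx0 : g⁻¹ * y ≠ 0 := mul_ne_zero (inv_ne_zero hg0) hy0
      have e : g * (g⁻¹ * y) = y := mul_inv_cancel_left₀ hg0 y
      refine ⟨g⁻¹ * y, ⟨hx0, ?_⟩, e⟩
      by_contra hc
      rw [← key _ hx0, e] at hc
      exact hy hc
  have h1 := hb.ncard_eq
  have h3 := Set.ncard_add_ncard_compl {x : K | IsSquare x}
  have h4 : {x : K | IsSquare x} = insert 0 {x : K | x ≠ 0 ∧ IsSquare x} := by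
    ext x
    by_cases hx : x = 0
    · subst hx; simp
    · simp [hx]
  have h5 : ({x : K | IsSquare x}).ncard = {x : K | x ≠ 0 ∧ IsSquare x}.ncard + 1 := by
    rw [h4, Set.ncard_insert_of_notMem (by simp)]
  have h6 : ({x : K | IsSquare x})ᶜ = {x : K | ¬ IsSquare x} := rfl
  rw [h6, h5, Nat.card_eq_fintype_card] at h3
  omega

lemma count_aux (F K : Type*) [Field F] [Fintype F] [Field K] [Fintype K]
    (hq : Odd (Fintype.card F)) (hK : Fintype.card K = Fintype.card F ^ 2)
    (P : F[X]) (hP : P.Monic) (hPd : P.natDegree = 2) (φ : F[X] →+* K)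
    (hs : Function.Surjective φ) (hk : ∀ f, φ f = 0 ↔ P ∣ f) :
    {Q : F[X] | Q.Monic ∧ Irreducible Q ∧ Q.natDegree = 2 ∧ ¬ IsSquare (φ Q)}.ncard
      = (Fintype.card F ^ 2 - 1) / 4 := by
  classical
  set q := Fintype.card F with hqdef
  have h2 : ringChar K ≠ 2 := by
    intro h
    have := FiniteField.even_card_of_char_two h
    have h' : Odd (q ^ 2) := hq.pow
    rw [hK] at this
    rw [Nat.odd_iff] at h'
    omega
  have hns := nonsq_count K h2
  rw [hK] at hns
  have inj : ∀ f g : F[X], f.degree < 2 → g.degree < 2 → φ f = φ g → f = g := by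
    intro f g hf hg h
    rw [← sub_eq_zero, ← map_sub, hk] at h
    rw [← sub_eq_zero]
    refine Polynomial.eq_zero_of_dvd_of_degree_lt h ?_
    rw [Polynomial.degree_eq_natDegree hP.ne_zero, hPd]
    exact lt_of_le_of_lt (degree_sub_le _ _) (max_lt hf hg)
  have hPdeg : P.degree = 2 := by
    rw [Polynomial.degree_eq_natDegree hP.ne_zero, hPd]; rfl
  have surj : ∀ x : K, ∃ f : F[X], f.degree < 2 ∧ φ f = x := by
    intro x
    obtain ⟨f, rfl⟩ := hs x
    refine ⟨f %ₘ P, hPdeg ▸ degree_modByMonic_lt f hP, ?_⟩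
    rw [← sub_eq_zero, ← map_sub, hk, modByMonic_eq_sub_mul_div]
    simp
  have φP : φ P = 0 := (hk P).2 dvd_rfl
  have hC : ∀ c : F, c ≠ 0 → φ (C c) ≠ 0 := by
    intro c hc h
    have := inj (C c) 0 (lt_of_le_of_lt degree_C_le (by norm_num)) (by rw [degree_zero]; exact WithBot.bot_lt_coe 2) (by simpa using h)
    simp at this
    exact hc this
  have hCsq : ∀ c : F, IsSquare (φ (C c)) := by
    intro c
    by_cases hc : c = 0
    · subst hc; simp
    rw [FiniteField.isSquare_iff h2 (hC c hc), hK]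
    obtain ⟨k, hk'⟩ := hq
    have e : q ^ 2 / 2 = (q - 1) * (k + 1) := by
      rw [hk']
      have : (2 * k + 1) ^ 2 = 2 * ((2 * k) * (k + 1)) + 1 := by ring
      rw [this]
      simp
      omega
    rw [e, pow_mul, ← map_pow, ← C_pow, FiniteField.pow_card_sub_one_eq_one c hc]
    simp
  have hlin : ∀ a : F, φ (X + C a) ≠ 0 := by
    intro a h
    have := inj (X + C a) 0 (by rw [degree_X_add_C]; norm_num) (by rw [degree_zero]; exact WithBot.bot_lt_coe 2) (by simpa using h)
    exact (X_add_C_ne_zero a) this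
  -- multiplicativity
  have hmul : ∀ x y : K, x ≠ 0 → y ≠ 0 → (IsSquare (x * y) ↔ (IsSquare x ↔ IsSquare y)) := by
    intro x y hx hy
    rw [← quadraticChar_one_iff_isSquare hx, ← quadraticChar_one_iff_isSquare hy,
      ← quadraticChar_one_iff_isSquare (mul_ne_zero hx hy), map_mul]
    rcases quadraticChar_dichotomy hx with h | h <;>
    rcases quadraticChar_dichotomy hy with h' | h' <;> simp [h, h']
  set Nm : Set F := {a | ¬ IsSquare (φ (X + C a))} with hNm
  set Np : Set F := {a | IsSquare (φ (X + C a))} with hNp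
  have hsum : Np.ncard + Nm.ncard = q := by
    have := Set.ncard_add_ncard_compl Np
    rwa [Nat.card_eq_fintype_card] at this
  -- count of Nm
  have hb1 : Set.BijOn (fun p : F × F => φ (C p.1 * (X + C p.2)))
      ({c : F | c ≠ 0} ×ˢ Nm) {x : K | ¬ IsSquare x} := by
    have hd : ∀ c a : F, (C c * (X + C a)).degree < 2 := by
      intro c a
      rw [mul_add, ← C_mul]
      exact lt_of_le_of_lt degree_linear_le (by norm_num)
    refine ⟨?_, ?_, ?_⟩
    · rintro ⟨c, a⟩ ⟨hc, ha⟩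
      simp only [Set.mem_setOf_eq, map_mul]
      rw [hmul _ _ (hC c hc) (hlin a)]
      intro h
      exact ha (h.1 (hCsq c))
    · rintro ⟨c, a⟩ ⟨hc, ha⟩ ⟨c', a'⟩ ⟨hc', ha'⟩ h
      have h := inj _ _ (hd _ _) (hd _ _) h
      have e1 := congrArg (fun f => coeff f 1) h
      have e0 := congrArg (fun f => coeff f 0) h
      simp at e1 e0
      subst e1
      rw [mul_left_cancel₀ hc e0]
    · intro x hx
      obtain ⟨f, hf, rfl⟩ := surj x
      have hf1 : f.degree ≤ 1 := by
        rw [degree_le_iff_coeff_zero]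
        intro m hm
        have hm' : 1 < m := by exact_mod_cast hm
        refine coeff_eq_zero_of_degree_lt (lt_of_lt_of_le hf ?_)
        exact_mod_cast hm'
      have ef := eq_X_add_C_of_degree_le_one hf1
      set c := f.coeff 1
      set d := f.coeff 0
      have hc : c ≠ 0 := by
        intro hc
        rw [ef, hc] at hx
        simp at hx
        exact hx (hCsq d)
      have ef' : f = C c * (X + C (c⁻¹ * d)) := by
        rw [mul_add, ← C_mul, mul_inv_cancel_left₀ hc]; exact ef
      refine ⟨(c, c⁻¹ * d), ⟨hc, ?_⟩, by simp only; rw [← ef']⟩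
      intro h
      apply hx
      rw [ef', map_mul]
      exact (hCsq c).mul h
  have c1 := hb1.ncard_eq
  have hcne : {c : F | c ≠ 0}.ncard = q - 1 := by
    have := Set.ncard_add_ncard_compl ({0} : Set F)
    rw [Nat.card_eq_fintype_card, Set.ncard_singleton] at this
    have e : ({0} : Set F)ᶜ = {c : F | c ≠ 0} := by ext; simp
    rw [e] at this
    omega
  rw [Set.ncard_prod, hcne] at c1
  -- all monic quadratics
  have hb2 : Set.BijOn φ {Q : F[X] | Q.Monic ∧ Q.natDegree = 2 ∧ ¬ IsSquare (φ Q)}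
      {x : K | ¬ IsSquare x} := by
    refine ⟨fun Q h => h.2.2, ?_, ?_⟩
    · rintro Q ⟨hQ, hQd, -⟩ Q' ⟨hQ', hQd', -⟩ h
      have hh : ∀ Q : F[X], Q.Monic → Q.natDegree = 2 → (Q - P).degree < 2 := by
        intro Q hQ hQd
        have hQdeg : Q.degree = 2 := by
          rw [Polynomial.degree_eq_natDegree hQ.ne_zero, hQd]; rfl
        rw [← hQdeg]
        exact degree_sub_lt (by rw [hQdeg, hPdeg]) hQ.ne_zero (by rw [hQ, hP])
      have := inj (Q - P) (Q' - P) (hh _ hQ hQd) (hh _ hQ' hQd') (by simp [h])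
      exact sub_left_injective this
    · intro x hx
      obtain ⟨f, hf, rfl⟩ := surj x
      have e : φ (P + f) = φ f := by simp [φP]
      refine ⟨P + f, ⟨hP.add_of_left (hPdeg ▸ hf), ?_, by rw [e]; exact hx⟩, e⟩
      rw [natDegree_add_eq_left_of_degree_lt (hPdeg ▸ hf), hPd]
  have c2 := hb2.ncard_eq
  -- reducible ones
  have hlm : ∀ a b : F, ((X + C a) * (X + C b)).Monic := fun a b =>
    (monic_X_add_C a).mul (monic_X_add_C b)
  have hld : ∀ a b : F, ((X + C a) * (X + C b)).natDegree = 2 := fun a b => by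
    rw [(monic_X_add_C a).natDegree_mul (monic_X_add_C b)]; simp
  have hl0 : ∀ a b : F, ((X + C a) * (X + C b)).coeff 0 = a * b := fun a b => by
    simp [mul_coeff_zero]
  have hl1 : ∀ a b : F, ((X + C a) * (X + C b)).coeff 1 = a + b := fun a b => by
    have : (X + C a) * (X + C b) = X ^ 2 + C (a + b) * X + C (a * b) := by
      simp only [C_add, C_mul]; ring
    rw [this]; simp [coeff_X_pow, coeff_C]
  have hb3 : Set.BijOn (fun p : F × F => (X + C p.1) * (X + C p.2)) (Np ×ˢ Nm)
      {Q : F[X] | (Q.Monic ∧ Q.natDegree = 2 ∧ ¬ IsSquare (φ Q)) ∧ ¬ Irreducible Q} := by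
    refine ⟨?_, ?_, ?_⟩
    · rintro ⟨a, b⟩ ⟨ha, hb⟩
      refine ⟨⟨hlm a b, hld a b, ?_⟩, ?_⟩
      · rw [map_mul, hmul _ _ (hlin a) (hlin b)]
        exact fun h => hb (h.1 ha)
      · rw [(hlm a b).not_irreducible_iff_exists_add_mul_eq_coeff (hld a b)]
        exact ⟨a, b, hl0 a b, hl1 a b⟩
    · rintro ⟨a, b⟩ ⟨ha, hb⟩ ⟨a', b'⟩ ⟨ha', hb'⟩ h
      simp only at h ha hb ha' hb'
      have e0 := hl0 a b
      have e1 := hl1 a b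
      rw [h, hl0] at e0
      rw [h, hl1] at e1
      have : (a - a') * (a - b') = 0 := by linear_combination e0 - a * e1
      rcases mul_eq_zero.1 this with h | h
      · have : a = a' := sub_eq_zero.1 h
        subst this
        simpa using e1.symm
      · have : a = b' := sub_eq_zero.1 h
        subst this
        exact absurd ha hb'
    · rintro Q ⟨⟨hQ, hQd, hQs⟩, hQi⟩
      rw [hQ.not_irreducible_iff_exists_add_mul_eq_coeff hQd] at hQi
      obtain ⟨a, b, h0, h1⟩ := hQi
      have eQ : Q = (X + C a) * (X + C b) := by
        have e := hQ.as_sum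
        rw [hQd, Finset.sum_range_succ, Finset.sum_range_one, h0, h1] at e
        rw [e]
        simp only [C_add, C_mul]; ring
      rw [eQ, map_mul, hmul _ _ (hlin a) (hlin b)] at hQs
      by_cases ha : IsSquare (φ (X + C a))
      · refine ⟨(a, b), ⟨ha, fun hb => hQs ⟨fun _ => hb, fun _ => ha⟩⟩, eQ.symm⟩
      · refine ⟨(b, a), ⟨?_, ha⟩, by simp only; rw [eQ, mul_comm]⟩
        by_contra hb
        exact hQs ⟨fun h => absurd h ha, fun h => absurd h hb⟩
  have c3 := hb3.ncard_eq
  rw [Set.ncard_prod] at c3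
  have hfin : {Q : F[X] | Q.Monic ∧ Q.natDegree = 2 ∧ ¬ IsSquare (φ Q)}.Finite :=
    hb2.finite_iff_finite.2 (Set.toFinite _)
  have hsplit : {Q : F[X] | Q.Monic ∧ Q.natDegree = 2 ∧ ¬ IsSquare (φ Q)} =
      {Q : F[X] | Q.Monic ∧ Irreducible Q ∧ Q.natDegree = 2 ∧ ¬ IsSquare (φ Q)} ∪
      {Q : F[X] | (Q.Monic ∧ Q.natDegree = 2 ∧ ¬ IsSquare (φ Q)) ∧ ¬ Irreducible Q} := by
    ext Q; simp only [Set.mem_setOf_eq, Set.mem_union]; tauto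
  have c4 := congrArg Set.ncard hsplit
  rw [Set.ncard_union_eq
    (Set.disjoint_left.2 fun Q h h' => h'.2 h.2.1)
    (hfin.subset fun Q h => ⟨h.1, h.2.2⟩) (hfin.subset fun Q h => h.1), c2, ← c3] at c4
  -- arithmetic
  obtain ⟨k, hk'⟩ := hq
  have hq1 : 1 < q := Fintype.one_lt_card
  rw [hk'] at hns c1 hsum hq1 ⊢
  have hkpos : 0 < k := by omega
  rw [Nat.add_sub_cancel] at c1
  have hm : Nm.ncard = k + 1 := by
    have : (4 * k) * Nm.ncard = (4 * k) * (k + 1) := by nlinarith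
    exact Nat.eq_of_mul_eq_mul_left (by omega) this
  have hp : Np.ncard = k := by omega
  rw [hm] at c1
  rw [hm, hp, ← c1] at c4
  have e : (2 * k + 1) ^ 2 - 1 = 4 * (k * (k + 1)) := by
    have : (2 * k + 1) ^ 2 = 4 * (k * (k + 1)) + 1 := by ring
    omega
  rw [e, Nat.mul_div_cancel_left _ (by norm_num)]
  have : 2 * k * (k + 1) = 2 * (k * (k + 1)) := by ring
  omega

/-- For `q` odd and `P` a monic irreducible quadratic over `F_q`, the number of monic
irreducible quadratics `Q` that are non-squares modulo `P` is `(q²-1)/4`; in particular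
such a `Q` exists. -/
theorem count_nonsquare_quadratics (F : Type*) [Field F] [Fintype F]
    (hq : Odd (Fintype.card F))
    (P : Polynomial F) (hP : P.Monic) (hPirr : Irreducible P) (hPd : P.natDegree = 2) :
    {Q : Polynomial F | Q.Monic ∧ Irreducible Q ∧ Q.natDegree = 2 ∧
        ¬ IsSquare (Ideal.Quotient.mk (Ideal.span {P}) Q)}.ncard
      = (Fintype.card F ^ 2 - 1) / 4 ∧
    {Q : Polynomial F | Q.Monic ∧ Irreducible Q ∧ Q.natDegree = 2 ∧
        ¬ IsSquare (Ideal.Quotient.mk (Ideal.span {P}) Q)}.Nonempty := by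
  have hmain : {Q : Polynomial F | Q.Monic ∧ Irreducible Q ∧ Q.natDegree = 2 ∧
        ¬ IsSquare (Ideal.Quotient.mk (Ideal.span {P}) Q)}.ncard
      = (Fintype.card F ^ 2 - 1) / 4 := by
    haveI : (Ideal.span {P}).IsMaximal :=
      PrincipalIdealRing.isMaximal_of_irreducible hPirr
    letI : Field (F[X] ⧸ Ideal.span {P}) := Ideal.Quotient.field _
    have hfr : Module.finrank F (F[X] ⧸ Ideal.span {P}) = 2 := by
      rw [finrank_quotient_span_eq_natDegree, hPd]
    haveI : Module.Finite F (F[X] ⧸ Ideal.span {P}) :=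
      Module.finite_of_finrank_pos (by rw [hfr]; norm_num)
    haveI : Finite (F[X] ⧸ Ideal.span {P}) := Module.finite_of_finite F
    letI : Fintype (F[X] ⧸ Ideal.span {P}) := Fintype.ofFinite _
    have hcard : Fintype.card (F[X] ⧸ Ideal.span {P}) = Fintype.card F ^ 2 := by
      rw [Module.card_eq_pow_finrank (K := F), hfr]
    exact count_aux F (F[X] ⧸ Ideal.span {P}) hq hcard P hP hPd (Ideal.Quotient.mk _)
      Ideal.Quotient.mk_surjective
      (fun f => by rw [Ideal.Quotient.eq_zero_iff_mem, Ideal.mem_span_singleton])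
  refine ⟨hmain, ?_⟩
  apply Set.nonempty_of_ncard_ne_zero
  rw [hmain]
  have hq1 : 1 < Fintype.card F := Fintype.one_lt_card
  have h3 : 3 ≤ Fintype.card F := by
    obtain ⟨k, hk⟩ := hq
    omega
  have : 9 ≤ Fintype.card F ^ 2 := by nlinarith
  omega
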